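/- Let 1 < p < ∞, 1 ≤ q < ∞ and 0 ≤ λ ≤ n. Suppose f, g are measurable functions on ℝⁿ and A > 0 is a constant such that |g(x)| ≤ A · Mf(x) for almost every x ∈ ℝⁿ (as holds, for instance, for g = B_{δ,*}f the maximal Bochner–Riesz function with δ > (n−1)/2). Then there is a constant C > 0, independent of f and g, such that ‖g‖_{𝓛_{p,q;λ}(ℝⁿ)} ≤ C·A·‖f‖_{𝓛_{p,q;λ}(ℝⁿ)}. -/

import Mathlib

open MeasureTheory ENNReal Set Metric

/-- Non-increasing rearrangement of an `ℝ≥0∞`-valued function on `ℝⁿ`: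
`g*(t) = inf {l | volume {x | g x > l} ≤ t}`. -/
noncomputable def rearr (n : ℕ) (g : EuclideanSpace ℝ (Fin n) → ℝ≥0∞) (t : ℝ) : ℝ≥0∞ :=
  sInf {l : ℝ≥0∞ | volume {x | l < g x} ≤ ENNReal.ofReal t}

/-- The fractional maximal operator
`M_α f (x) = sup_{r>0} |B(x,r)|^(α/n - 1) ∫_{B(x,r)} |f|`. -/
noncomputable def fracMax (n : ℕ) (α : ℝ) (f : EuclideanSpace ℝ (Fin n) → ℝ)
    (x : EuclideanSpace ℝ (Fin n)) : ℝ≥0∞ :=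
  ⨆ r : {r : ℝ // 0 < r},
    volume (ball x r.1) ^ (α / n - 1 : ℝ) * ∫⁻ y in ball x r.1, ENNReal.ofReal |f y|

/-- `f**(t) = (1/t) ∫₀^t f*(s) ds` for a real-valued `f` on `ℝⁿ`. -/
noncomputable def dstar (n : ℕ) (f : EuclideanSpace ℝ (Fin n) → ℝ) (t : ℝ) : ℝ≥0∞ :=
  ENNReal.ofReal (1 / t) *
    ∫⁻ s in Set.Ioc (0 : ℝ) t, rearr n (fun y => ENNReal.ofReal |f y|) s

/-- Lorentz norm `‖g‖_{L_{p,q}} = (∫₀^∞ (t^{1/p} g*(t))^q dt/t)^{1/q}`, with the usual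
supremum modification when `q = ∞`. -/
noncomputable def lorentzNorm (n : ℕ) (p : ℝ) (q : ℝ≥0∞)
    (g : EuclideanSpace ℝ (Fin n) → ℝ≥0∞) : ℝ≥0∞ :=
  if q = ⊤ then
    ⨆ t : {t : ℝ // 0 < t}, ENNReal.ofReal (t.1 ^ (1 / p)) * rearr n g t.1
  else
    (∫⁻ t in Set.Ioi (0 : ℝ),
        (ENNReal.ofReal (t ^ (1 / p)) * rearr n g t) ^ q.toReal * ENNReal.ofReal (1 / t)) ^
      (1 / q.toReal)

/-- Lorentz–Morrey norm
`‖g‖_{𝓛_{p,q;λ}} = sup_{x, r>0} r^{-λ/p} ‖g χ_{B(x,r)}‖_{L_{p,q}}`. -/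
noncomputable def lorentzMorrey (n : ℕ) (p : ℝ) (q : ℝ≥0∞) (lam : ℝ)
    (g : EuclideanSpace ℝ (Fin n) → ℝ≥0∞) : ℝ≥0∞ :=
  ⨆ (x : EuclideanSpace ℝ (Fin n)) (r : {r : ℝ // 0 < r}),
    ENNReal.ofReal (r.1 ^ (-(lam / p))) * lorentzNorm n p q ((ball x r.1).indicator g)

section helpers

open Filter Topology

/-- Hardy--Littlewood maximal function of a nonnegative function. -/
noncomputable def hlMax (n : ℕ) (h : EuclideanSpace ℝ (Fin n) → ℝ≥0∞)
    (x : EuclideanSpace ℝ (Fin n)) : ℝ≥0∞ :=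
  ⨆ r : {r : ℝ // 0 < r}, (volume (ball x r.1))⁻¹ * ∫⁻ y in ball x r.1, h y

theorem fracMax_eq (n : ℕ) (f : EuclideanSpace ℝ (Fin n) → ℝ) (x : EuclideanSpace ℝ (Fin n)) :
    fracMax n 0 f x = hlMax n (fun y => ENNReal.ofReal |f y|) x := by
  unfold fracMax hlMax
  simp [ENNReal.rpow_neg_one]

theorem rearr_le {n : ℕ} {g : EuclideanSpace ℝ (Fin n) → ℝ≥0∞} {t : ℝ} {l : ℝ≥0∞}
    (h : volume {x | l < g x} ≤ ENNReal.ofReal t) : rearr n g t ≤ l := sInf_le h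

theorem rearr_antitone (n : ℕ) (g : EuclideanSpace ℝ (Fin n) → ℝ≥0∞) : Antitone (rearr n g) := by
  intro s t hst
  exact sInf_le_sInf fun l hl => le_trans hl (ENNReal.ofReal_le_ofReal hst)

theorem rearr_measurable (n : ℕ) (g : EuclideanSpace ℝ (Fin n) → ℝ≥0∞) :
    Measurable (rearr n g) := (rearr_antitone n g).measurable

theorem volume_rearr_lt_le (n : ℕ) (g : EuclideanSpace ℝ (Fin n) → ℝ≥0∞) (t : ℝ) :
    volume {x | rearr n g t < g x} ≤ ENNReal.ofReal t := by
  have hne : {l : ℝ≥0∞ | volume {x | l < g x} ≤ ENNReal.ofReal t}.Nonempty := ⟨⊤, by simp⟩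
  obtain ⟨u, hu, hlim, hmem⟩ := exists_seq_tendsto_sInf hne (OrderBot.bddBelow _)
  have hset : {x | rearr n g t < g x} ⊆ ⋃ k, {x | u k < g x} := by
    intro x hx
    have := (hlim.eventually (gt_mem_nhds hx)).exists
    simpa using this
  refine (measure_mono hset).trans ?_
  rw [Monotone.measure_iUnion]
  · exact iSup_le hmem
  · intro a b hab x hx
    exact lt_of_le_of_lt (hu hab) hx

theorem volume_ball_scale (n : ℕ) (x : EuclideanSpace ℝ (Fin n)) {c r : ℝ} (hc : 0 < c)
    (hr : 0 < r) : volume (ball x (c * r)) = ENNReal.ofReal (c ^ n) * volume (ball x r) := by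
  rw [Measure.addHaar_ball_of_pos _ _ (mul_pos hc hr), Measure.addHaar_ball_of_pos _ _ hr,
    ← mul_assoc, ← ENNReal.ofReal_mul (by positivity), mul_pow]
  simp

theorem weak_type (n : ℕ) (h : EuclideanSpace ℝ (Fin n) → ℝ≥0∞) {t : ℝ} (ht : 0 < t) :
    volume {x | ENNReal.ofReal (5 ^ n) * (∫⁻ y, h y) / ENNReal.ofReal t < hlMax n h x}
      ≤ ENNReal.ofReal t := by
  set I := ∫⁻ y, h y with hI
  set s := ENNReal.ofReal (5 ^ n) * I / ENNReal.ofReal t with hs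
  have h5 : ENNReal.ofReal (5 ^ n) ≠ 0 := by simp
  have ht0 : ENNReal.ofReal t ≠ 0 := by simpa using ht
  by_cases hItop : I = ⊤
  · have : s = ⊤ := by
      rw [hs, hItop, ENNReal.mul_top h5, ENNReal.top_div_of_ne_top ENNReal.ofReal_ne_top]
    simp [this]
  let S : ℕ → Set (EuclideanSpace ℝ (Fin n)) := fun R =>
    {x | ∃ r : ℝ, 0 < r ∧ r ≤ R ∧ s < (volume (ball x r))⁻¹ * ∫⁻ y in ball x r, h y}
  have hsub : {x | s < hlMax n h x} ⊆ ⋃ R, S R := by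
    intro x hx
    simp only [mem_ofPred_eq, hlMax, lt_iSup_iff] at hx
    obtain ⟨⟨r, hr⟩, hx⟩ := hx
    obtain ⟨R, hR⟩ := exists_nat_ge r
    exact mem_iUnion.2 ⟨R, r, hr, hR, hx⟩
  refine (measure_mono hsub).trans ?_
  rw [Monotone.measure_iUnion]
  swap
  · rintro a b hab x ⟨r, h1, h2, h3⟩
    exact ⟨r, h1, h2.trans (by exact_mod_cast hab), h3⟩
  refine iSup_le fun R => ?_
  choose! r hr0 hrR hrs using fun x (hx : x ∈ S R) => hx
  obtain ⟨u, huS, hdisj, hcov⟩ := Vitali.exists_disjoint_subfamily_covering_enlargement_closedBall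
    (S R) (fun x => x) r R hrR 4 (by norm_num)
  have hdisjb : u.PairwiseDisjoint fun x => ball x (r x) :=
    hdisj.mono_on fun x _ => ball_subset_closedBall
  have hcount : u.Countable := hdisjb.countable_of_isOpen (fun _ _ => isOpen_ball)
    (fun x hx => nonempty_ball.2 (hr0 x (huS hx)))
  have hcover : S R ⊆ ⋃ x ∈ u, ball x (5 * r x) := by
    intro x hx
    obtain ⟨b, hb, hsubb⟩ := hcov x hx
    have := hsubb (mem_closedBall_self (hr0 x hx).le)
    refine mem_biUnion hb (mem_ball.2 (lt_of_le_of_lt (mem_closedBall.1 this) ?_))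
    have := hr0 b (huS hb)
    linarith
  have hball : ∀ x ∈ u, s * volume (ball x (r x)) ≤ ∫⁻ y in ball x (r x), h y := by
    intro x hx
    have h1 := (hrs x (huS hx)).le
    have hv0 : volume (ball x (r x)) ≠ 0 := (measure_ball_pos _ _ (hr0 x (huS hx))).ne'
    have hvt : volume (ball x (r x)) ≠ ⊤ := measure_ball_lt_top.ne
    calc _ ≤ (volume (ball x (r x)))⁻¹ * (∫⁻ y in ball x (r x), h y) * volume (ball x (r x)) := by
            gcongr
      _ = (volume (ball x (r x)) * (volume (ball x (r x)))⁻¹) * (∫⁻ y in ball x (r x), h y) := by ring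
      _ = _ := by rw [ENNReal.mul_inv_cancel hv0 hvt, one_mul]
  have hsum : s * ∑' x : u, volume (ball x.1 (r x.1)) ≤ I := by
    rw [← ENNReal.tsum_mul_left]
    calc _ ≤ ∑' x : u, ∫⁻ y in ball x.1 (r x.1), h y := ENNReal.tsum_le_tsum fun x => hball x.1 x.2
      _ = ∫⁻ y in ⋃ x ∈ u, ball x (r x), h y :=
          (lintegral_biUnion hcount (fun _ _ => measurableSet_ball) hdisjb _).symm
      _ ≤ I := setLIntegral_le_lintegral _ _
  have hmeas : volume (S R) ≤ ENNReal.ofReal (5 ^ n) * ∑' x : u, volume (ball x.1 (r x.1)) := by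
    rw [← ENNReal.tsum_mul_left]
    calc _ ≤ volume (⋃ x ∈ u, ball x (5 * r x)) := measure_mono hcover
      _ ≤ ∑' x : u, volume (ball x.1 (5 * r x.1)) := measure_biUnion_le _ hcount _
      _ = _ := by
        congr 1; ext x
        exact volume_ball_scale n _ (by norm_num) (hr0 _ (huS x.2))
  by_cases hI0 : I = 0
  · have : S R = ∅ := by
      rw [eq_empty_iff_forall_notMem]
      intro x hx
      have := hrs x hx
      have h2 : ∫⁻ y in ball x (r x), h y = 0 :=
        le_antisymm ((setLIntegral_le_lintegral _ _).trans hI0.le) zero_le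
      simp [h2] at this
    simp [this]
  set V := ∑' x : u, volume (ball x.1 (r x.1))
  refine hmeas.trans ?_
  have h6 : I * (ENNReal.ofReal (5 ^ n) * V) ≤ I * ENNReal.ofReal t := by
    calc _ = (ENNReal.ofReal t * (ENNReal.ofReal t)⁻¹) * (ENNReal.ofReal (5 ^ n) * I * V) := by
            rw [ENNReal.mul_inv_cancel ht0 ENNReal.ofReal_ne_top]; ring
      _ = ENNReal.ofReal t * (s * V) := by rw [hs, ENNReal.div_eq_inv_mul]; ring
      _ ≤ ENNReal.ofReal t * I := by gcongr
      _ = _ := mul_comm _ _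
  exact (ENNReal.mul_le_mul_iff_right hI0 hItop).1 h6

theorem lintegral_tail_le (n : ℕ) (h : EuclideanSpace ℝ (Fin n) → ℝ≥0∞) (hm : Measurable h)
    {t : ℝ} :
    ∫⁻ x in {x | rearr n h t < h x}, h x
      ≤ ∑' k : ℕ, ENNReal.ofReal (t / 2 ^ k) * rearr n h (t / 2 ^ (k + 1)) := by
  set c : ℕ → ℝ≥0∞ := fun k => rearr n h (t / 2 ^ k) with hc
  have hc0 : rearr n h t = c 0 := by simp [hc]
  have hms : ∀ k, MeasurableSet {x | c k < h x} := fun k => measurableSet_lt measurable_const hm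
  have hvol : ∀ k, volume {x | c k < h x} ≤ ENNReal.ofReal (t / 2 ^ k) :=
    fun k => volume_rearr_lt_le n h _
  have hnull : volume {x | ∀ k, c k < h x} = 0 := by
    have hlim : Tendsto (fun k : ℕ => ENNReal.ofReal (t / 2 ^ k)) atTop (𝓝 0) := by
      rw [← ENNReal.ofReal_zero]
      refine ENNReal.tendsto_ofReal ?_
      have := (tendsto_pow_atTop_nhds_zero_of_lt_one (r := (1 / 2 : ℝ)) (by norm_num)
        (by norm_num)).const_mul t
      simpa [div_eq_mul_inv] using this
    refine le_antisymm (ge_of_tendsto' hlim fun k => ?_) zero_le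
    exact (measure_mono (show {x | ∀ k, c k < h x} ⊆ {x | c k < h x} from fun x hx => hx k)).trans
      (hvol k)
  have hae : ∀ᵐ x, {x | c 0 < h x}.indicator h x
      ≤ ∑' k, {x | c k < h x}.indicator (fun _ => c (k + 1)) x := by
    have : ∀ᵐ x, ¬ ∀ k, c k < h x := by
      rw [ae_iff]; simpa using hnull
    filter_upwards [this] with x hx
    by_cases h0 : c 0 < h x
    · push Not at hx
      classical
      have hk := Nat.find_spec hx
      obtain ⟨j, hj⟩ : ∃ j, Nat.find hx = j + 1 :=
        Nat.exists_eq_succ_of_ne_zero (fun h' => by rw [h'] at hk; exact absurd h0 hk.not_gt)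
      have hj' : c j < h x := not_le.1 (Nat.find_min hx (by omega))
      rw [hj] at hk
      refine le_trans ?_ (ENNReal.le_tsum j)
      rw [indicator_of_mem (show x ∈ {x | c 0 < h x} from h0),
        indicator_of_mem (show x ∈ {x | c j < h x} from hj')]
      exact hk
    · rw [indicator_of_notMem (show x ∉ {x | c 0 < h x} from h0)]
      exact zero_le
  rw [hc0, ← lintegral_indicator (hms 0)]
  refine (lintegral_mono_ae hae).trans ?_
  rw [lintegral_tsum fun k => (measurable_const.indicator (hms k)).aemeasurable]
  refine ENNReal.tsum_le_tsum fun k => ?_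
  rw [lintegral_indicator_const (hms k), mul_comm]
  gcongr
  exact hvol k

theorem hlMax_add_const_le (n : ℕ) (h h1 : EuclideanSpace ℝ (Fin n) → ℝ≥0∞) (c : ℝ≥0∞)
    (hh : ∀ x, h x ≤ h1 x + c) (x : EuclideanSpace ℝ (Fin n)) :
    hlMax n h x ≤ hlMax n h1 x + c := by
  refine iSup_le fun r => ?_
  have hv0 : volume (ball x r.1) ≠ 0 := (measure_ball_pos _ _ r.2).ne'
  have hvt : volume (ball x r.1) ≠ ⊤ := measure_ball_lt_top.ne
  calc _ ≤ (volume (ball x r.1))⁻¹ * ∫⁻ y in ball x r.1, (h1 y + c) := by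
        gcongr with y; exact hh y
    _ = (volume (ball x r.1))⁻¹ * (∫⁻ y in ball x r.1, h1 y)
        + (volume (ball x r.1))⁻¹ * volume (ball x r.1) * c := by
        rw [lintegral_add_right _ measurable_const, setLIntegral_const]; ring
    _ ≤ _ := by
        rw [ENNReal.inv_mul_cancel hv0 hvt, one_mul]
        gcongr
        exact le_iSup (fun r : {r : ℝ // 0 < r} =>
          (volume (ball x r.1))⁻¹ * ∫⁻ y in ball x r.1, h1 y) r

theorem rearr_hlMax_le (n : ℕ) (h : EuclideanSpace ℝ (Fin n) → ℝ≥0∞) (hm : Measurable h)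
    {t : ℝ} (ht : 0 < t) :
    rearr n (hlMax n h) t ≤ ENNReal.ofReal (1 + 2 * 5 ^ n) *
      ∑' k : ℕ, (2⁻¹ : ℝ≥0∞) ^ k * rearr n h (t / 2 ^ k) := by
  set T := {x | rearr n h t < h x} with hT
  have hTm : MeasurableSet T := measurableSet_lt measurable_const hm
  set S := ∑' k : ℕ, (2⁻¹ : ℝ≥0∞) ^ k * rearr n h (t / 2 ^ k) with hS
  have hle : ∀ x, h x ≤ T.indicator h x + rearr n h t := by
    intro x
    by_cases hx : x ∈ T
    · simp [hx]
    · simp only [hx, not_false_eq_true, indicator_of_notMem, zero_add]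
      exact not_lt.1 hx
  have h1 : rearr n (hlMax n h) t ≤
      ENNReal.ofReal (5 ^ n) * (∫⁻ y, T.indicator h y) / ENNReal.ofReal t + rearr n h t := by
    refine rearr_le ((measure_mono ?_).trans (weak_type n (T.indicator h) ht))
    intro x hx
    have := lt_of_lt_of_le hx (hlMax_add_const_le n h _ _ hle x)
    exact lt_of_add_lt_add_right this
  have ht0 : ENNReal.ofReal t ≠ 0 := by simpa using ht
  have h2 : (∫⁻ y, T.indicator h y) / ENNReal.ofReal t ≤ 2 * S := by
    rw [lintegral_indicator hTm]
    refine ENNReal.div_le_of_le_mul ((lintegral_tail_le n h hm).trans ?_)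
    calc _ = ∑' k : ℕ, 2 * ((2⁻¹ : ℝ≥0∞) ^ (k + 1) * rearr n h (t / 2 ^ (k + 1)))
          * ENNReal.ofReal t := by
          congr 1; ext k
          rw [div_eq_mul_inv, ENNReal.ofReal_mul ht.le, ENNReal.ofReal_inv_of_pos (by positivity),
            ENNReal.ofReal_pow (by norm_num), ENNReal.inv_pow, pow_succ,
            show ENNReal.ofReal 2 = 2 by simp]
          calc _ = (2 * 2⁻¹ : ℝ≥0∞) * (ENNReal.ofReal t * (2⁻¹ : ℝ≥0∞) ^ k * rearr n h (t / 2 ^ k / 2)) := by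
                rw [ENNReal.mul_inv_cancel (by norm_num) (by norm_num), one_mul,
                  div_div]
            _ = _ := by rw [pow_succ, div_div]; ring
      _ = 2 * (∑' k : ℕ, (2⁻¹ : ℝ≥0∞) ^ (k + 1) * rearr n h (t / 2 ^ (k + 1)))
          * ENNReal.ofReal t := by rw [ENNReal.tsum_mul_right, ENNReal.tsum_mul_left]
      _ ≤ _ := by
        gcongr
        rw [hS]
        exact ENNReal.tsum_comp_le_tsum_of_injective (add_left_injective 1)
          (fun k : ℕ => (2⁻¹ : ℝ≥0∞) ^ k * rearr n h (t / 2 ^ k))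
  have h3 : rearr n h t ≤ S := by
    have := ENNReal.le_tsum (f := fun k : ℕ => (2⁻¹ : ℝ≥0∞) ^ k * rearr n h (t / 2 ^ k)) 0
    simpa using this
  calc _ ≤ _ := h1
    _ = ENNReal.ofReal (5 ^ n) * ((∫⁻ y, T.indicator h y) / ENNReal.ofReal t) + rearr n h t := by
      rw [mul_div_assoc]
    _ ≤ ENNReal.ofReal (5 ^ n) * (2 * S) + S := by gcongr
    _ = _ := by
      rw [ENNReal.ofReal_add (by norm_num) (by positivity), ENNReal.ofReal_mul (by norm_num)]
      simp; ring

/-- The `q`-th power of the Lorentz functional of a function on `(0, ∞)`. -/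
noncomputable def lorI (ρ q : ℝ) (F : ℝ → ℝ≥0∞) : ℝ≥0∞ :=
  ∫⁻ t in Ioi (0 : ℝ), (ENNReal.ofReal (t ^ ρ) * F t) ^ q * ENNReal.ofReal (1 / t)

theorem lorentzNorm_eq (n : ℕ) (p q : ℝ) (hq : 1 ≤ q)
    (g : EuclideanSpace ℝ (Fin n) → ℝ≥0∞) :
    lorentzNorm n p (ENNReal.ofReal q) g = (lorI (1 / p) q (rearr n g)) ^ (1 / q) := by
  unfold lorentzNorm lorI
  rw [if_neg ENNReal.ofReal_ne_top, ENNReal.toReal_ofReal (by linarith)]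

theorem lorI_mono {ρ q : ℝ} (hq : 1 ≤ q) {F G : ℝ → ℝ≥0∞} (h : ∀ t, 0 < t → F t ≤ G t) :
    lorI ρ q F ≤ lorI ρ q G := by
  refine setLIntegral_mono' measurableSet_Ioi fun t ht => ?_
  gcongr
  exact h t ht

theorem lorI_meas (ρ q : ℝ) {F : ℝ → ℝ≥0∞} (hF : Measurable F) :
    Measurable fun t : ℝ => (ENNReal.ofReal (t ^ ρ) * F t) ^ q * ENNReal.ofReal (1 / t) := by
  fun_prop

theorem lorI_const {ρ q : ℝ} (hq : 1 ≤ q) (c : ℝ≥0∞) {F : ℝ → ℝ≥0∞} (hF : Measurable F) :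
    lorI ρ q (fun t => c * F t) = c ^ q * lorI ρ q F := by
  unfold lorI
  rw [← lintegral_const_mul _ (lorI_meas ρ q hF)]
  congr 1; ext t
  rw [show ENNReal.ofReal (t ^ ρ) * (c * F t) = c * (ENNReal.ofReal (t ^ ρ) * F t) by ring,
    ENNReal.mul_rpow_of_nonneg _ _ (by linarith : (0 : ℝ) ≤ q), mul_assoc]

theorem lintegral_scale {c : ℝ} (hc : 0 < c) {G : ℝ → ℝ≥0∞} (hG : Measurable G) :
    ∫⁻ t in Ioi (0 : ℝ), G t = ENNReal.ofReal c * ∫⁻ t in Ioi (0 : ℝ), G (c * t) := by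
  rw [← lintegral_indicator measurableSet_Ioi, ← lintegral_indicator measurableSet_Ioi]
  conv_lhs => rw [← Real.smul_map_volume_mul_left hc.ne']
  rw [lintegral_smul_measure, lintegral_map (hG.indicator measurableSet_Ioi) (by fun_prop),
    abs_of_pos hc, smul_eq_mul]
  congr 2; ext t
  by_cases ht : 0 < t
  · rw [indicator_of_mem (by simp only [mem_Ioi]; positivity), indicator_of_mem (by simpa using ht)]
  · rw [indicator_of_notMem, indicator_of_notMem (by simpa using ht)]
    simp only [mem_Ioi, not_lt] at ht ⊢
    exact mul_nonpos_of_nonneg_of_nonpos hc.le ht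

theorem lorI_scale {ρ q : ℝ} (hq : 1 ≤ q) {c : ℝ} (hc : 0 < c) {F : ℝ → ℝ≥0∞}
    (hF : Measurable F) :
    lorI ρ q (fun t => F (t / c)) = ENNReal.ofReal (c ^ ρ) ^ q * lorI ρ q F := by
  have hq0 : (0 : ℝ) ≤ q := by linarith
  unfold lorI
  rw [lintegral_scale hc (lorI_meas ρ q (F := fun t => F (t / c)) (hF.comp (by fun_prop : Measurable fun t : ℝ => t / c))),
    ← lintegral_const_mul _ (lorI_meas ρ q hF), ← lintegral_const_mul]
  swap
  · fun_prop
  refine setLIntegral_congr_fun measurableSet_Ioi fun t ht => ?_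
  have ht : 0 < t := ht
  rw [mul_div_cancel_left₀ _ hc.ne', Real.mul_rpow hc.le ht.le,
    ENNReal.ofReal_mul (by positivity), mul_assoc (ENNReal.ofReal (c ^ ρ)),
    ENNReal.mul_rpow_of_nonneg _ _ hq0, show 1 / (c * t) = c⁻¹ * (1 / t) by field_simp,
    ENNReal.ofReal_mul (by positivity), ENNReal.ofReal_inv_of_pos hc]
  calc _ = (ENNReal.ofReal c * (ENNReal.ofReal c)⁻¹) * (ENNReal.ofReal (c ^ ρ) ^ q *
        ((ENNReal.ofReal (t ^ ρ) * F t) ^ q * ENNReal.ofReal (1 / t))) := by ring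
    _ = _ := by
      rw [ENNReal.mul_inv_cancel (by simpa using hc) ENNReal.ofReal_ne_top, one_mul]

theorem iSup_rpow_le_tsum {q : ℝ} (hq : 1 ≤ q) (x : ℕ → ℝ≥0∞) :
    (⨆ k, x k) ^ q ≤ ∑' k, x k ^ q := by
  have hq0 : 0 < q := by linarith
  rw [← ENNReal.le_rpow_inv_iff hq0]
  refine iSup_le fun k => ?_
  rw [ENNReal.le_rpow_inv_iff hq0]
  exact ENNReal.le_tsum (f := fun k => x k ^ q) k

theorem lorI_iSup_le {ρ q : ℝ} (hq : 1 ≤ q) {F : ℕ → ℝ → ℝ≥0∞} (hF : ∀ k, Measurable (F k)) :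
    lorI ρ q (fun t => ⨆ k, F k t) ≤ ∑' k, lorI ρ q (F k) := by
  unfold lorI
  rw [← lintegral_tsum fun k => (lorI_meas ρ q (hF k)).aemeasurable]
  refine lintegral_mono fun t => ?_
  simp only
  rw [ENNReal.tsum_mul_right, ENNReal.mul_iSup]
  gcongr
  exact iSup_rpow_le_tsum hq _

theorem lorI_max_le {ρ q : ℝ} {F G : ℝ → ℝ≥0∞} (hF : Measurable F) :
    lorI ρ q (fun t => max (F t) (G t)) ≤ lorI ρ q F + lorI ρ q G := by
  unfold lorI
  rw [← lintegral_add_left (lorI_meas ρ q hF)]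
  refine lintegral_mono fun t => ?_
  simp only
  rcases max_cases (F t) (G t) with h | h
  · rw [h.1]; exact le_self_add
  · rw [h.1]; exact le_add_self

/-- Lorentz boundedness of the dyadic Hardy sum. -/
theorem lorI_hardy {ρ q : ℝ} (hρ : ρ < 1) (hq : 1 ≤ q) :
    ∃ C : ℝ≥0∞, C ≠ ⊤ ∧ ∀ F : ℝ → ℝ≥0∞, Measurable F →
      lorI ρ q (fun t => ∑' k : ℕ, (2⁻¹ : ℝ≥0∞) ^ k * F (t / 2 ^ k)) ≤ C * lorI ρ q F := by
  have hq0 : (0 : ℝ) ≤ q := by linarith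
  set a : ℝ := 2 ^ (-((1 - ρ) / 2)) with ha
  set b : ℝ := 2 ^ (-((1 + ρ) / 2)) with hb
  have ha0 : 0 < a := by positivity
  have hb0 : 0 < b := by positivity
  have ha1 : a < 1 := Real.rpow_lt_one_of_one_lt_of_neg (by norm_num) (by linarith)
  have hab : a * b = 2⁻¹ := by
    rw [ha, hb, ← Real.rpow_add (by norm_num), ← Real.rpow_neg_one]; congr 1; ring
  have hb2 : b * 2 ^ ρ = a := by
    rw [ha, hb, ← Real.rpow_add (by norm_num)]; congr 1; ring
  set W : ℝ≥0∞ := ∑' k : ℕ, ENNReal.ofReal a ^ k with hW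
  have haE : ENNReal.ofReal a < 1 := by simpa using ha1
  have hWt : W ≠ ⊤ := by
    rw [hW, ENNReal.tsum_geometric]
    exact ENNReal.inv_ne_top.2 (tsub_pos_of_lt haE).ne'
  have haq : ENNReal.ofReal a ^ q < 1 := ENNReal.rpow_lt_one haE (by linarith)
  set W' : ℝ≥0∞ := ∑' k : ℕ, (ENNReal.ofReal a ^ q) ^ k with hW'
  have hWt' : W' ≠ ⊤ := by
    rw [hW', ENNReal.tsum_geometric]
    exact ENNReal.inv_ne_top.2 (tsub_pos_of_lt haq).ne'
  refine ⟨W ^ q * W', ENNReal.mul_ne_top (ENNReal.rpow_ne_top_of_nonneg hq0 hWt) hWt', ?_⟩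
  intro F hF
  have hmF : ∀ k : ℕ, Measurable fun t : ℝ => F (t / 2 ^ k) :=
    fun k => hF.comp (by fun_prop)
  have hmF' : ∀ k : ℕ, Measurable fun t : ℝ => ENNReal.ofReal b ^ k * F (t / 2 ^ k) :=
    fun k => (hmF k).const_mul _
  calc _ ≤ lorI ρ q (fun t => W * ⨆ k : ℕ, ENNReal.ofReal b ^ k * F (t / 2 ^ k)) := by
        refine lorI_mono hq fun t _ => ?_
        rw [hW, ← ENNReal.tsum_mul_right]
        refine ENNReal.tsum_le_tsum fun k => ?_
        have : (2⁻¹ : ℝ≥0∞) = ENNReal.ofReal a * ENNReal.ofReal b := by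
          rw [← ENNReal.ofReal_mul ha0.le, hab, ENNReal.ofReal_inv_of_pos (by norm_num)]; simp
        rw [this, mul_pow, mul_assoc]
        gcongr
        exact le_iSup (fun k : ℕ => ENNReal.ofReal b ^ k * F (t / 2 ^ k)) k
    _ = W ^ q * lorI ρ q (fun t => ⨆ k : ℕ, ENNReal.ofReal b ^ k * F (t / 2 ^ k)) :=
        lorI_const hq W (Measurable.iSup hmF')
    _ ≤ W ^ q * ∑' k : ℕ, lorI ρ q (fun t => ENNReal.ofReal b ^ k * F (t / 2 ^ k)) := by
        gcongr
        exact lorI_iSup_le hq hmF'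
    _ = W ^ q * ∑' k : ℕ, (ENNReal.ofReal a ^ q) ^ k * lorI ρ q F := by
        congr 2; ext k
        rw [lorI_const hq _ (hmF k), lorI_scale hq (by positivity) hF, ← mul_assoc,
          ← ENNReal.mul_rpow_of_nonneg _ _ hq0, ← hb2, ← ENNReal.ofReal_pow hb0.le,
          ← ENNReal.ofReal_mul (by positivity), ← ENNReal.rpow_natCast (_ ^ q),
          ← ENNReal.rpow_mul, mul_comm q, ENNReal.rpow_mul, ENNReal.rpow_natCast,
          ← ENNReal.ofReal_pow (by positivity), mul_pow, ← Real.rpow_natCast,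
          ← Real.rpow_natCast ((2 : ℝ) ^ ρ), ← Real.rpow_mul (by norm_num) ρ, mul_comm ρ,
          Real.rpow_mul (by norm_num) _ ρ, Real.rpow_natCast, Real.rpow_natCast]
    _ = _ := by rw [ENNReal.tsum_mul_right, mul_assoc]

theorem lorI_indicator_ne_top {ρ q : ℝ} (hρ : 0 < ρ) (hq : 1 ≤ q) :
    lorI ρ q ((Iio (1 : ℝ)).indicator fun _ => 1) ≠ ⊤ := by
  have hint : IntegrableOn (fun t : ℝ => t ^ (ρ * q - 1)) (Ioo 0 1) := by
    rw [intervalIntegral.integrableOn_Ioo_rpow_iff one_pos]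
    have : 0 < ρ * q := by positivity
    linarith
  refine ne_top_of_le_ne_top (hint.lintegral_lt_top).ne ?_
  unfold lorI
  rw [← lintegral_indicator measurableSet_Ioi, ← lintegral_indicator measurableSet_Ioo]
  refine lintegral_mono fun t => ?_
  simp only
  by_cases h0 : 0 < t
  · rw [indicator_of_mem (show t ∈ Ioi 0 from h0)]
    by_cases h1 : t < 1
    · rw [indicator_of_mem (show t ∈ Iio 1 from h1), indicator_of_mem (show t ∈ Ioo 0 1 from ⟨h0, h1⟩),
        mul_one, ENNReal.ofReal_rpow_of_nonneg (by positivity) (by linarith),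
        ← ENNReal.ofReal_mul (by positivity), ← Real.rpow_mul h0.le, Real.rpow_sub h0, Real.rpow_one]
      apply le_of_eq; congr 1; ring
    · rw [indicator_of_notMem (show t ∉ Iio 1 from h1), mul_zero,
        ENNReal.zero_rpow_of_pos (by linarith), zero_mul]
      exact zero_le
  · rw [indicator_of_notMem (show t ∉ Ioi 0 from h0)]
    exact zero_le

theorem lorI_lower {ρ q : ℝ} (hρ : 0 < ρ) (hq : 1 ≤ q) {F : ℝ → ℝ≥0∞} (hF : Antitone F) {s : ℝ}
    (hs : 0 < s) :
    ENNReal.ofReal ((s / 2) ^ ρ) * F s ≤ 2 * lorI ρ q F ^ (1 / q) := by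
  have hq0 : (0 : ℝ) < q := by linarith
  have h1 : (ENNReal.ofReal ((s / 2) ^ ρ) * F s) ^ q * 2⁻¹ ≤ lorI ρ q F := by
    calc _ = ∫⁻ t in Ioc (s / 2) s,
          (ENNReal.ofReal ((s / 2) ^ ρ) * F s) ^ q * ENNReal.ofReal (1 / s) := by
          rw [setLIntegral_const, Real.volume_Ioc, mul_assoc, ← ENNReal.ofReal_mul (by positivity),
            show 1 / s * (s - s / 2) = 2⁻¹ by field_simp; ring,
            ENNReal.ofReal_inv_of_pos (by norm_num)]
          simp
      _ ≤ ∫⁻ t in Ioc (s / 2) s, (ENNReal.ofReal (t ^ ρ) * F t) ^ q * ENNReal.ofReal (1 / t) := by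
          refine setLIntegral_mono' measurableSet_Ioc fun t ht => ?_
          have h0 : 0 < t := by linarith [ht.1]
          have h2 : F s ≤ F t := hF ht.2
          have h3 := ht.1.le
          have h4 := ht.2
          gcongr
      _ ≤ _ := lintegral_mono_set fun t ht => by
          have := ht.1
          simp only [mem_Ioi]; linarith
  have h2 : (ENNReal.ofReal ((s / 2) ^ ρ) * F s) ^ q ≤ 2 * lorI ρ q F := by
    rw [← div_eq_mul_inv] at h1
    have := (ENNReal.div_le_iff (by norm_num) (by norm_num)).1 h1
    rwa [mul_comm (lorI ρ q F)] at this
  rw [← ENNReal.le_rpow_inv_iff hq0, ENNReal.mul_rpow_of_nonneg _ _ (by positivity)] at h2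
  refine h2.trans ?_
  rw [one_div]
  gcongr
  calc (2 : ℝ≥0∞) ^ q⁻¹ ≤ 2 ^ (1 : ℝ) :=
        ENNReal.rpow_le_rpow_of_exponent_le (by norm_num) (inv_le_one_of_one_le₀ hq)
    _ = 2 := ENNReal.rpow_one _

theorem lintegral_le_lorI {ρ q : ℝ} (hρ0 : 0 < ρ) (hρ : ρ < 1) (hq : 1 ≤ q) (n : ℕ) :
    ∃ C : ℝ≥0∞, C ≠ ⊤ ∧ ∀ (h : EuclideanSpace ℝ (Fin n) → ℝ≥0∞) (t : ℝ), Measurable h → 0 < t →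
      rearr n h t = 0 →
      ∫⁻ x, h x ≤ C * ENNReal.ofReal (t ^ (1 - ρ)) * lorI ρ q (rearr n h) ^ (1 / q) := by
  set a : ℝ := 2 ^ (ρ - 1) with ha
  have ha0 : 0 < a := by positivity
  have ha1 : a < 1 := Real.rpow_lt_one_of_one_lt_of_neg (by norm_num) (by linarith)
  have haE : ENNReal.ofReal a < 1 := by simpa using ha1
  set W : ℝ≥0∞ := ∑' k : ℕ, ENNReal.ofReal a ^ k with hW
  have hWt : W ≠ ⊤ := by
    rw [hW, ENNReal.tsum_geometric]
    exact ENNReal.inv_ne_top.2 (tsub_pos_of_lt haE).ne'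
  refine ⟨W * (ENNReal.ofReal (4 ^ ρ) * 2), ENNReal.mul_ne_top hWt
    (ENNReal.mul_ne_top ENNReal.ofReal_ne_top (by norm_num)), ?_⟩
  intro h t hm ht h0
  set J := lorI ρ q (rearr n h) ^ (1 / q) with hJ
  have h1 : ∫⁻ x, h x = ∫⁻ x in {x | rearr n h t < h x}, h x := by
    rw [h0, ← lintegral_indicator (measurableSet_lt measurable_const hm)]
    congr 1; ext x
    by_cases hx : 0 < h x
    · rw [indicator_of_mem (show x ∈ {x | 0 < h x} from hx)]
    · rw [indicator_of_notMem (show x ∉ {x | 0 < h x} from hx)]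
      simpa using hx
  rw [h1]
  refine (lintegral_tail_le n h hm).trans ?_
  calc _ ≤ ∑' k : ℕ, ENNReal.ofReal a ^ k *
        (ENNReal.ofReal (4 ^ ρ) * 2 * ENNReal.ofReal (t ^ (1 - ρ)) * J) := by
        refine ENNReal.tsum_le_tsum fun k => ?_
        have hs : 0 < t / 2 ^ (k + 1) := by positivity
        have hlow := lorI_lower (ρ := ρ) hρ0 hq (rearr_antitone n h) hs
        have e1 : t / 2 ^ k = a ^ k * (4 ^ ρ * t ^ (1 - ρ)) * (t / 2 ^ (k + 1) / 2) ^ ρ := by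
          have e2 : t / 2 ^ (k + 1) / 2 = t * ((2 ^ k)⁻¹ * 4⁻¹) := by
            rw [pow_succ]; field_simp; norm_num
          have e3 : a ^ k = (2 ^ k) ^ ρ * ((2 : ℝ) ^ k)⁻¹ := by
            rw [ha, ← Real.rpow_natCast, ← Real.rpow_mul (by norm_num), ← Real.rpow_natCast 2 k,
              ← Real.rpow_mul (by norm_num), ← Real.rpow_neg (by norm_num),
              ← Real.rpow_add (by norm_num)]
            congr 1; ring
          rw [e2, e3, Real.mul_rpow ht.le (by positivity), Real.mul_rpow (by positivity) (by norm_num),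
            Real.inv_rpow (by positivity), Real.inv_rpow (by positivity), Real.rpow_sub ht,
            Real.rpow_one]
          have p1 : (0 : ℝ) < t ^ ρ := by positivity
          have p2 : (0 : ℝ) < (2 ^ k) ^ ρ := by positivity
          have p3 : (0 : ℝ) < 4 ^ ρ := by positivity
          field_simp
        rw [e1, ENNReal.ofReal_mul (by positivity), ENNReal.ofReal_mul (by positivity),
          ENNReal.ofReal_mul (by positivity), ENNReal.ofReal_pow ha0.le, mul_assoc]
        calc _ ≤ ENNReal.ofReal a ^ k * (ENNReal.ofReal (4 ^ ρ) * ENNReal.ofReal (t ^ (1 - ρ))) *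
              (2 * J) := by gcongr
          _ = _ := by ring
    _ = _ := by rw [ENNReal.tsum_mul_right]; ring

theorem volume_ball_formula (n : ℕ) : ∃ v : ℝ, 0 < v ∧
    ∀ (x : EuclideanSpace ℝ (Fin n)) (r : ℝ), 0 < r →
      volume (ball x r) = ENNReal.ofReal (v * r ^ n) := by
  refine ⟨(volume (ball (0 : EuclideanSpace ℝ (Fin n)) 1)).toReal,
    ENNReal.toReal_pos (measure_ball_pos _ _ one_pos).ne' measure_ball_lt_top.ne, fun x r hr => ?_⟩
  rw [Measure.addHaar_ball_of_pos _ _ hr, ENNReal.ofReal_mul ENNReal.toReal_nonneg,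
    ENNReal.ofReal_toReal measure_ball_lt_top.ne, mul_comm]
  simp

theorem lorI_le_morrey (n : ℕ) (p q lam : ℝ) (hq : 1 ≤ q)
    (F : EuclideanSpace ℝ (Fin n) → ℝ≥0∞) (x : EuclideanSpace ℝ (Fin n)) {r : ℝ} (hr : 0 < r) :
    lorI (1 / p) q (rearr n ((ball x r).indicator F)) ^ (1 / q) ≤
      ENNReal.ofReal (r ^ (lam / p)) * lorentzMorrey n p (ENNReal.ofReal q) lam F := by
  rw [← lorentzNorm_eq n p q hq]
  set L := lorentzNorm n p (ENNReal.ofReal q) ((ball x r).indicator F) with hL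
  have h1 : ENNReal.ofReal (r ^ (-(lam / p))) * L ≤ lorentzMorrey n p (ENNReal.ofReal q) lam F :=
    le_iSup_of_le x (le_iSup (fun r : {r : ℝ // 0 < r} => ENNReal.ofReal (r.1 ^ (-(lam / p))) *
      lorentzNorm n p (ENNReal.ofReal q) ((ball x r.1).indicator F)) ⟨r, hr⟩)
  calc L = ENNReal.ofReal (r ^ (lam / p)) * (ENNReal.ofReal (r ^ (-(lam / p))) * L) := by
        rw [← mul_assoc, ← ENNReal.ofReal_mul (by positivity), ← Real.rpow_add hr]; simp
    _ ≤ _ := by gcongr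

theorem morrey_maximal_aux (n : ℕ) (p q lam : ℝ) (hp : 1 < p) (hq : 1 ≤ q) (hln : lam ≤ n) :
    ∃ D : ℝ≥0∞, D ≠ ⊤ ∧ ∀ (f g : EuclideanSpace ℝ (Fin n) → ℝ≥0∞) (A : ℝ≥0∞),
      Measurable f → (∀ᵐ x, g x ≤ A * hlMax n f x) →
      lorentzMorrey n p (ENNReal.ofReal q) lam g ≤
        A * D * lorentzMorrey n p (ENNReal.ofReal q) lam f := by
  have hq0 : (0 : ℝ) < q := by linarith
  set ρ : ℝ := 1 / p with hρdef
  have hρ0 : 0 < ρ := by positivity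
  have hρ1 : ρ < 1 := by rw [hρdef, div_lt_one (by linarith)]; exact hp
  obtain ⟨v, hv, hvol⟩ := volume_ball_formula n
  obtain ⟨Ch, hCh, hardy⟩ := lorI_hardy (ρ := ρ) (q := q) hρ1 hq
  obtain ⟨CH, hCH, holder⟩ := lintegral_le_lorI (ρ := ρ) (q := q) hρ0 hρ1 hq n
  set I1 := lorI ρ q ((Iio (1 : ℝ)).indicator fun _ => 1) with hI1
  have hI1t : I1 ≠ ⊤ := lorI_indicator_ne_top hρ0 hq
  set c2 : ℝ≥0∞ := ENNReal.ofReal (1 + 2 * 5 ^ n) with hc2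
  set c3 : ℝ≥0∞ := ENNReal.ofReal (2 ^ (lam / p)) with hc3
  set D : ℝ≥0∞ := c2 ^ q * (Ch * c3 ^ q) + CH ^ q * I1 with hD
  have hDt : D ≠ ⊤ := by
    rw [hD]
    exact ENNReal.add_ne_top.2 ⟨ENNReal.mul_ne_top
      (ENNReal.rpow_ne_top_of_nonneg hq0.le ENNReal.ofReal_ne_top)
      (ENNReal.mul_ne_top hCh (ENNReal.rpow_ne_top_of_nonneg hq0.le ENNReal.ofReal_ne_top)),
      ENNReal.mul_ne_top (ENNReal.rpow_ne_top_of_nonneg hq0.le hCH) hI1t⟩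
  refine ⟨D ^ (1 / q), ENNReal.rpow_ne_top_of_nonneg (by positivity) hDt, ?_⟩
  intro f g A hf hg
  set N := lorentzMorrey n p (ENNReal.ofReal q) lam f with hN
  refine iSup_le fun x => iSup_le fun ⟨r, hr⟩ => ?_
  simp only
  rw [lorentzNorm_eq n p q hq]
  set X := ENNReal.ofReal (r ^ (lam / p)) * N with hX
  set h := (ball x (2 * r)).indicator f with hh
  have hhm : Measurable h := hf.indicator measurableSet_ball
  set K : ℝ≥0∞ := CH * ENNReal.ofReal (v ^ (-ρ) * r ^ ((lam - n) / p)) * N with hK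
  set T : ℝ := v * r ^ n with hT
  have hTpos : 0 < T := by positivity
  -- averages over large balls
  have havg : ∀ y : EuclideanSpace ℝ (Fin n), ∀ s : ℝ, r ≤ s →
      (volume (ball y s))⁻¹ * ∫⁻ z in ball y s, f z ≤ K := by
    intro y s hrs
    have hs : 0 < s := hr.trans_le hrs
    have ht : 0 < v * s ^ n := by positivity
    have hz : rearr n ((ball y s).indicator f) (v * s ^ n) = 0 := by
      refine le_antisymm (rearr_le ?_) zero_le
      rw [← hvol y s hs]
      refine measure_mono fun z hz => ?_
      by_contra hzn
      have hz' : 0 < (ball y s).indicator f z := hz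
      rw [indicator_of_notMem hzn] at hz'
      exact lt_irrefl _ hz'
    have h1 := holder _ _ (hf.indicator measurableSet_ball) ht hz
    rw [lintegral_indicator measurableSet_ball] at h1
    rw [hvol y s hs]
    calc _ ≤ (ENNReal.ofReal (v * s ^ n))⁻¹ * (CH * ENNReal.ofReal ((v * s ^ n) ^ (1 - ρ)) *
          (ENNReal.ofReal (s ^ (lam / p)) * N)) := by
          gcongr
          refine h1.trans ?_
          gcongr
          exact lorI_le_morrey n p q lam hq f y hs
      _ = CH * ENNReal.ofReal ((v * s ^ n)⁻¹ * (v * s ^ n) ^ (1 - ρ) * s ^ (lam / p)) * N := by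
          rw [ENNReal.ofReal_mul (p := (v * s ^ n)⁻¹ * (v * s ^ n) ^ (1 - ρ)) (by positivity),
            ENNReal.ofReal_mul (p := (v * s ^ n)⁻¹) (by positivity),
            ENNReal.ofReal_inv_of_pos ht]
          ring
      _ ≤ K := by
          rw [hK]
          refine mul_le_mul_left (mul_le_mul_right (ENNReal.ofReal_le_ofReal ?_) _) _
          calc (v * s ^ n)⁻¹ * (v * s ^ n) ^ (1 - ρ) * s ^ (lam / p)
              = v ^ (-ρ) * s ^ ((lam - n) / p) := by
                rw [← Real.rpow_neg_one, ← Real.rpow_add ht, show -1 + (1 - ρ) = -ρ by ring,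
                  Real.mul_rpow hv.le (by positivity), ← Real.rpow_natCast s n,
                  ← Real.rpow_mul hs.le, mul_assoc, ← Real.rpow_add hs, hρdef]
                congr 2; ring
            _ ≤ _ := by
                refine mul_le_mul_of_nonneg_left ?_ (by positivity)
                exact Real.rpow_le_rpow_of_nonpos hr hrs
                  (div_nonpos_of_nonpos_of_nonneg (by linarith) (by linarith))
  have hpt : ∀ y ∈ ball x r, hlMax n f y ≤ max (hlMax n h y) K := by
    intro y hy
    refine iSup_le fun ⟨s, hs⟩ => ?_
    rcases le_total r s with hrs | hrs
    · exact (havg y s hrs).trans (le_max_right _ _)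
    · refine le_trans ?_ (le_max_left _ _)
      have hsub : ball y s ⊆ ball x (2 * r) := by
        apply ball_subset_ball'
        have := mem_ball.1 hy
        linarith
      have : ∫⁻ z in ball y s, f z = ∫⁻ z in ball y s, h z := by
        refine setLIntegral_congr_fun measurableSet_ball fun z hz => ?_
        rw [hh, indicator_of_mem (hsub hz)]
      simp only
      rw [this]
      exact le_iSup (fun s : {s : ℝ // 0 < s} =>
        (volume (ball y s.1))⁻¹ * ∫⁻ z in ball y s.1, h z) ⟨s, hs⟩
  set G := (ball x r).indicator g with hG
  set Ms := rearr n (hlMax n h) with hMs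
  set B : ℝ → ℝ≥0∞ := (Iio (1 : ℝ)).indicator fun _ => 1 with hB
  have hBm : Measurable B := measurable_const.indicator measurableSet_Iio
  have hre : ∀ t, 0 < t → rearr n G t ≤ A * max (Ms t) (K * B (t / T)) := by
    intro t ht
    rcases le_or_gt T t with htT | htT
    · refine le_trans (rearr_le (l := 0) ?_) zero_le
      refine le_trans ?_ (ENNReal.ofReal_le_ofReal htT)
      rw [← hvol x r hr]
      refine measure_mono fun z hz => ?_
      by_contra hzn
      have hz' : 0 < (ball x r).indicator g z := hz
      rw [indicator_of_notMem hzn] at hz'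
      exact lt_irrefl _ hz'
    · have : B (t / T) = 1 := indicator_of_mem (by simpa [div_lt_one hTpos] using htT) _
      rw [this, mul_one]
      refine rearr_le (le_trans (measure_mono_ae ?_) (volume_rearr_lt_le n (hlMax n h) t))
      filter_upwards [hg] with y hgy
      intro hy
      have hy' : A * max (Ms t) K < G y := hy
      show Ms t < hlMax n h y
      have hyb : y ∈ ball x r := by
        by_contra hzn
        rw [hG, indicator_of_notMem hzn] at hy'
        exact ENNReal.not_lt_zero hy'
      rw [hG, indicator_of_mem hyb] at hy'
      by_contra hcon
      have hcon := not_lt.1 hcon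
      refine absurd hy' (not_lt.2 (hgy.trans ?_))
      gcongr
      refine (hpt y hyb).trans ?_
      gcongr
  have hMsm : Measurable Ms := rearr_measurable _ _
  have hBTm : Measurable fun t : ℝ => B (t / T) := hBm.comp (by fun_prop)
  have hI2 : lorI ρ q Ms ≤ c2 ^ q * (Ch * (c3 * X) ^ q) := by
    have hmm : Measurable fun t : ℝ => ∑' k : ℕ, (2⁻¹ : ℝ≥0∞) ^ k * rearr n h (t / 2 ^ k) :=
      Measurable.tsum fun k =>
        ((rearr_measurable n h).comp (by fun_prop : Measurable fun t : ℝ => t / 2 ^ k)).const_mul _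
    calc _ ≤ lorI ρ q (fun t => c2 * ∑' k : ℕ, (2⁻¹ : ℝ≥0∞) ^ k * rearr n h (t / 2 ^ k)) :=
          lorI_mono hq fun t ht => rearr_hlMax_le n h hhm ht
      _ = c2 ^ q * lorI ρ q (fun t => ∑' k : ℕ, (2⁻¹ : ℝ≥0∞) ^ k * rearr n h (t / 2 ^ k)) :=
          lorI_const hq _ hmm
      _ ≤ c2 ^ q * (Ch * lorI ρ q (rearr n h)) := by
          gcongr
          exact hardy _ (rearr_measurable n h)
      _ ≤ _ := by
          gcongr
          have := lorI_le_morrey n p q lam hq f x (show 0 < 2 * r by positivity)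
          rw [Real.mul_rpow (by norm_num) hr.le, ENNReal.ofReal_mul (by positivity), mul_assoc,
            one_div q, ENNReal.rpow_inv_le_iff hq0] at this
          exact this
  have hKT : K * ENNReal.ofReal (T ^ ρ) = CH * X := by
    rw [hK, hX]
    calc _ = CH * (ENNReal.ofReal (v ^ (-ρ) * r ^ ((lam - n) / p)) * ENNReal.ofReal (T ^ ρ)) * N := by
          ring
      _ = CH * ENNReal.ofReal (r ^ (lam / p)) * N := by
          rw [← ENNReal.ofReal_mul (by positivity)]
          congr 3
          rw [hT, Real.mul_rpow hv.le (by positivity), ← Real.rpow_natCast r n, ← Real.rpow_mul hr.le]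
          calc _ = (v ^ (-ρ) * v ^ ρ) * (r ^ ((lam - n) / p) * r ^ (n * ρ)) := by ring
            _ = _ := by
              rw [← Real.rpow_add hv, ← Real.rpow_add hr, hρdef]
              simp only [neg_add_cancel, Real.rpow_zero, one_mul]
              congr 1; ring
      _ = _ := by ring
  have hI3 : lorI ρ q (fun t => K * B (t / T)) = CH ^ q * I1 * X ^ q := by
    rw [lorI_const hq _ hBTm, lorI_scale hq hTpos hBm, ← mul_assoc,
      ← ENNReal.mul_rpow_of_nonneg _ _ hq0.le, hKT, ENNReal.mul_rpow_of_nonneg _ _ hq0.le]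
    ring
  have hfin : lorI ρ q (rearr n G) ≤ (A * D ^ (1 / q) * X) ^ q := by
    calc _ ≤ lorI ρ q (fun t => A * max (Ms t) (K * B (t / T))) := lorI_mono hq hre
      _ = A ^ q * lorI ρ q (fun t => max (Ms t) (K * B (t / T))) :=
          lorI_const hq _ (hMsm.max (hBTm.const_mul K))
      _ ≤ A ^ q * (lorI ρ q Ms + lorI ρ q (fun t => K * B (t / T))) := by
          gcongr
          exact lorI_max_le hMsm
      _ ≤ A ^ q * (c2 ^ q * (Ch * (c3 * X) ^ q) + CH ^ q * I1 * X ^ q) := by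
          rw [hI3]
          gcongr
      _ = _ := by
          rw [ENNReal.mul_rpow_of_nonneg c3 X hq0.le, ENNReal.mul_rpow_of_nonneg _ X hq0.le,
            ENNReal.mul_rpow_of_nonneg A _ hq0.le, ← ENNReal.rpow_mul, one_div,
            inv_mul_cancel₀ hq0.ne', ENNReal.rpow_one, hD]
          ring
  rw [← ENNReal.rpow_inv_le_iff hq0, ← one_div] at hfin
  calc _ ≤ ENNReal.ofReal (r ^ (-(lam / p))) * (A * D ^ (1 / q) * X) := by gcongr
    _ = (ENNReal.ofReal (r ^ (-(lam / p))) * ENNReal.ofReal (r ^ (lam / p))) *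
        (A * D ^ (1 / q) * N) := by rw [hX]; ring
    _ = _ := by
      rw [← ENNReal.ofReal_mul (by positivity), ← Real.rpow_add hr]; simp

end helpers

/-- for `1 < p < ∞`, `1 ≤ q < ∞`, `0 ≤ λ ≤ n` there is `C > 0` independent of
`f, g` such that whenever `|g| ≤ A · Mf` a.e. (e.g. `g = B_{δ,*}f`), one has
`‖g‖_{𝓛_{p,q;λ}} ≤ C·A·‖f‖_{𝓛_{p,q;λ}}`. -/
theorem stmt_10 (n : ℕ) (p q lam : ℝ) (hp : 1 < p) (hq : 1 ≤ q)
    (hl0 : 0 ≤ lam) (hln : lam ≤ n) :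
    ∃ C : ℝ, 0 < C ∧ ∀ (f g : EuclideanSpace ℝ (Fin n) → ℝ) (A : ℝ), 0 < A →
      Measurable f → Measurable g →
      (∀ᵐ x ∂(volume : Measure (EuclideanSpace ℝ (Fin n))),
        ENNReal.ofReal |g x| ≤ ENNReal.ofReal A * fracMax n 0 f x) →
      lorentzMorrey n p (ENNReal.ofReal q) lam (fun x => ENNReal.ofReal |g x|) ≤
        ENNReal.ofReal (C * A) * lorentzMorrey n p (ENNReal.ofReal q) lam
          (fun x => ENNReal.ofReal |f x|) := by

  obtain ⟨D, hD, hmain⟩ := morrey_maximal_aux n p q lam hp hq hln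
  refine ⟨D.toReal + 1, by positivity, fun f g A hA hf hg hfg => ?_⟩
  have hfm : Measurable fun x => ENNReal.ofReal |f x| := by fun_prop
  refine (hmain (fun x => ENNReal.ofReal |f x|) (fun x => ENNReal.ofReal |g x|)
    (ENNReal.ofReal A) hfm ?_).trans ?_
  · filter_upwards [hfg] with x hx
    rwa [fracMax_eq] at hx
  · gcongr
    rw [mul_comm, ENNReal.ofReal_mul (by positivity)]
    gcongr
    rw [ENNReal.ofReal_add (by positivity) (by norm_num), ENNReal.ofReal_toReal hD]
    exact le_self_add
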